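/- Let r ≥ 0 be an integer and n = 2·3^r. Then the set {(x,y) ∈ ℚ̄² : g^n(x,y) = (x,y)} has exactly 3^n elements. -/

import Mathlib

/-- A fixed algebraic closure of `ℚ`. -/
noncomputable def Qbar : Type := AlgebraicClosure ℚ

noncomputable instance : Field Qbar := inferInstanceAs (Field (AlgebraicClosure ℚ))
noncomputable instance : Algebra ℚ Qbar := inferInstanceAs (Algebra ℚ (AlgebraicClosure ℚ))

/-- The Hénon map `g(x,y) = (y, x + y - y³)` on `ℚ̄²`. -/
noncomputable def gA (P : Qbar × Qbar) : Qbar × Qbar :=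
  (P.2, P.1 + P.2 - P.2 ^ 3)

section spanning

variable {ι K A : Type*} [Fintype ι] [Field K] [CommRing A] [Algebra K A]

/-- The span of the monomials in the `x i` all of whose exponents are less than `3`. -/
def cubicReducedSpan (K : Type*) [Field K] [Algebra K A] (x : ι → A) : Submodule K A :=
  Submodule.span K (Set.range fun f : ι → Fin 3 => ∏ i, x i ^ (f i : ℕ))

theorem aeval_monomial_mem_cubicReducedSpan {x : ι → A}
    (hx : ∀ i, x i ^ 3 ∈ Submodule.span K (Set.range x)) (e : ι →₀ ℕ) :
    MvPolynomial.aeval x (MvPolynomial.monomial e (1 : K)) ∈ cubicReducedSpan K x := by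
  classical
  induction h : e.degree using Nat.strong_induction_on generalizing e with
  | _ d ih =>
  by_cases he : ∀ i, e i < 3
  · refine Submodule.subset_span ⟨fun i => ⟨e i, he i⟩, ?_⟩
    simp [MvPolynomial.aeval_monomial, Finsupp.prod_fintype]
  · push Not at he
    obtain ⟨i, hi⟩ := he
    obtain ⟨e', rfl⟩ : ∃ e', e = e' + Finsupp.single i 3 :=
      ⟨e - Finsupp.single i 3, (tsub_add_cancel_of_le (by simpa using hi)).symm⟩
    have key : Submodule.span K (Set.range x) ≤ (cubicReducedSpan K x).comap
        (LinearMap.mulLeft K (MvPolynomial.aeval x (MvPolynomial.monomial e' (1 : K)))) := by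
      rw [Submodule.span_le]
      rintro _ ⟨j, rfl⟩
      have := ih (e' + Finsupp.single j 1).degree (by simp [← h]) _ rfl
      simpa [MvPolynomial.aeval_monomial, Finsupp.prod_add_index', pow_add] using this
    have := key (hx i)
    simpa [MvPolynomial.aeval_monomial, Finsupp.prod_add_index', pow_add] using this

theorem aeval_mem_cubicReducedSpan {x : ι → A}
    (hx : ∀ i, x i ^ 3 ∈ Submodule.span K (Set.range x)) (p : MvPolynomial ι K) :
    MvPolynomial.aeval x p ∈ cubicReducedSpan K x := by
  induction p using MvPolynomial.induction_on' with
  | monomial e a =>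
    have := (cubicReducedSpan K x).smul_mem a (aeval_monomial_mem_cubicReducedSpan hx e)
    rwa [← map_smul, MvPolynomial.smul_monomial, smul_eq_mul, mul_one] at this
  | add p q hp hq =>
    rw [map_add]
    exact add_mem hp hq

theorem isIntegral_of_cube_mem_span {x : ι → A}
    (hx : ∀ i, x i ^ 3 ∈ Submodule.span K (Set.range x)) (i : ι) : IsIntegral K (x i) := by
  refine IsIntegral.of_mem_of_fg (MvPolynomial.aeval (R := K) x).range ?_ _
    ⟨MvPolynomial.X i, by simp⟩
  have h : Subalgebra.toSubmodule (MvPolynomial.aeval (R := K) x).range = cubicReducedSpan K x := by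
    apply le_antisymm
    · rintro _ ⟨p, rfl⟩
      exact aeval_mem_cubicReducedSpan hx p
    · refine Submodule.span_le.2 ?_
      rintro _ ⟨f, rfl⟩
      exact ⟨∏ i, MvPolynomial.X i ^ (f i : ℕ), by simp⟩
  rw [h]
  exact Submodule.fg_span (Set.finite_range _)

theorem card_le_of_cube_mem_span (S : Finset (ι → K))
    (hS : ∀ i, (fun P : S => P.1 i ^ 3) ∈
      Submodule.span K (Set.range fun (i : ι) (P : S) => P.1 i)) :
    S.card ≤ 3 ^ Fintype.card ι := by
  classical
  let x : ι → S → K := fun i P => P.1 i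
  have htop : cubicReducedSpan K x = ⊤ := by
    rw [eq_top_iff, ← (Pi.basisFun K S).span_eq, Submodule.span_le]
    rintro _ ⟨P, rfl⟩
    have heval (p : MvPolynomial ι K) (R : S) :
        MvPolynomial.aeval x p R = MvPolynomial.eval R.1 p := by
      induction p using MvPolynomial.induction_on with
      | C a => simp
      | add p q hp hq => simp [hp, hq]
      | mul_X p i hp => simp [hp, x]
    have hsep : ∀ Q : S, ∃ p : MvPolynomial ι K, MvPolynomial.eval P.1 p = 1 ∧
        (Q ≠ P → MvPolynomial.eval Q.1 p = 0) := by
      intro Q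
      by_cases hQ : Q = P
      · exact ⟨1, by simp, fun h => (h hQ).elim⟩
      · obtain ⟨i, hi⟩ := Function.ne_iff.1 (fun h => hQ (Subtype.ext h.symm) : P.1 ≠ Q.1)
        exact ⟨.C (P.1 i - Q.1 i)⁻¹ * (.X i - .C (Q.1 i)),
          by simp [inv_mul_cancel₀ (sub_ne_zero.2 hi)], by simp⟩
    choose p hp1 hp0 using hsep
    have hmem := aeval_mem_cubicReducedSpan (K := K) (x := x) hS (∏ Q, p Q)
    have : Pi.basisFun K S P = MvPolynomial.aeval x (∏ Q, p Q) := by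
      ext R
      rw [heval, map_prod, Pi.basisFun_apply]
      by_cases hR : R = P
      · subst hR
        rw [Pi.single_eq_same, Finset.prod_eq_one fun Q _ => hp1 Q]
      · rw [Pi.single_eq_of_ne hR, Finset.prod_eq_zero (Finset.mem_univ R) (hp0 R hR)]
    rwa [this]
  have h1 : Module.finrank K (cubicReducedSpan K x) ≤ _ := finrank_range_le_card _
  rw [htop, finrank_top] at h1
  simpa using h1

end spanning

section cyclic

variable {R S : Type*} [CommRing R] [CommRing S] {n : ℕ}

/-- The linear map `v ↦ (i ↦ v i + v (i - s) - v (i + s))` on cyclic sequences. -/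
def cyclicMap (R : Type*) [CommRing R] {n : ℕ} (s : ZMod n) :
    (ZMod n → R) →ₗ[R] (ZMod n → R) where
  toFun v i := v i + v (i - s) - v (i + s)
  map_add' v w := by ext i; simp only [Pi.add_apply]; ring
  map_smul' a v := by ext i; simp only [Pi.smul_apply, smul_eq_mul, RingHom.id_apply]; ring

theorem cyclicMap_apply (s : ZMod n) (v : ZMod n → R) (i : ZMod n) :
    cyclicMap R s v i = v i + v (i - s) - v (i + s) := rfl

theorem cyclicMap_comp_ringHom (f : R →+* S) (s : ZMod n) (v : ZMod n → R) :
    cyclicMap S s (f ∘ v) = f ∘ cyclicMap R s v := by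
  ext i
  simp [cyclicMap_apply]

theorem iterate_cyclicMap_comp_ringHom (f : R →+* S) (s : ZMod n) (k : ℕ) (v : ZMod n → R) :
    (cyclicMap S s)^[k] (f ∘ v) = f ∘ (cyclicMap R s)^[k] v :=
  ((show Function.Semiconj (f ∘ ·) (cyclicMap R s) (cyclicMap S s) from
    fun v => (cyclicMap_comp_ringHom f s v).symm).iterate_right k v).symm

theorem iterate_three_cyclicMap (h3 : (3 : R) = 0) (s : ZMod n) :
    (cyclicMap R s)^[3] = cyclicMap R (3 * s) := by
  ext v i
  simp only [Function.iterate_succ, Function.iterate_zero, Function.comp_apply, id, cyclicMap_apply,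
    sub_add_cancel, add_sub_cancel_right]
  rw [show i - s - s - s = i - 3 * s by ring, show i + s + s + s = i + 3 * s by ring]
  linear_combination (-2 * v i + v (i - s - s) + v (i + s + s)) * h3

theorem iterate_cyclicMap_eq_id (h3 : (3 : R) = 0) (r : ℕ) (hn : n = 2 * 3 ^ r) :
    (cyclicMap R (1 : ZMod n))^[3 ^ r] = id := by
  have key (k : ℕ) : (cyclicMap R (1 : ZMod n))^[3 ^ k] = cyclicMap R (3 ^ k : ZMod n) := by
    induction k with
    | zero => simp
    | succ k ih => rw [pow_succ, Function.iterate_mul, ih, iterate_three_cyclicMap h3, pow_succ']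
  rw [key]
  ext v i
  have h0 : (2 * 3 ^ r : ZMod n) = 0 := by
    have h := (ZMod.natCast_eq_zero_iff (2 * 3 ^ r) n).2 (dvd_of_eq hn)
    exact_mod_cast h
  rw [cyclicMap_apply, show i - 3 ^ r = i + 3 ^ r by linear_combination -h0]
  simp

/-- Hensel lifting for the system `x ^ 3 = L x`, with `L` invertible modulo `3`. -/
theorem exists_lift_of_cube_eq_cyclicMap [IsAdicComplete (Ideal.span {(3 : R)}) R] (r : ℕ)
    (hn : n = 2 * 3 ^ r) (x₀ : ZMod n → R)
    (h₀ : ∀ i, 3 ∣ x₀ i ^ 3 - cyclicMap R 1 x₀ i) :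
    ∃ x : ZMod n → R, (∀ i, x i ^ 3 = cyclicMap R 1 x i) ∧ ∀ i, 3 ∣ x i - x₀ i := by
  set L := cyclicMap R (1 : ZMod n) with hL
  let M : Module.End R (ZMod n → R) := L ^ (3 ^ r - 1)
  have hLM (v) : L (M v) = L^[3 ^ r] v := by
    rw [← Module.End.pow_apply, ← Module.End.mul_apply, ← pow_succ',
      Nat.sub_add_cancel (Nat.one_le_pow _ _ three_pos)]
  have hM_dvd (k : ℕ) (v : ZMod n → R) (hv : ∀ i, 3 ^ k ∣ v i) (i) : 3 ^ k ∣ M v i := by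
    choose w hw using hv
    obtain rfl : v = (3 : R) ^ k • w := funext hw
    rw [map_smul]
    exact ⟨_, rfl⟩
  have hLM_dvd (k : ℕ) (v : ZMod n → R) (hv : ∀ i, 3 ^ k ∣ v i) (i) :
      3 ^ (k + 1) ∣ L (M v) i - v i := by
    choose w hw using hv
    obtain rfl : v = (3 : R) ^ k • w := funext hw
    rw [map_smul, map_smul, hLM, Pi.smul_apply, Pi.smul_apply, ← smul_sub, smul_eq_mul, pow_succ]
    refine mul_dvd_mul_left _ ?_
    rw [← Ideal.mem_span_singleton, ← Ideal.Quotient.eq]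
    have h3 : (3 : R ⧸ Ideal.span {(3 : R)}) = 0 :=
      Ideal.Quotient.eq_zero_iff_mem.2 (Ideal.mem_span_singleton_self (3 : R))
    have := congrFun (iterate_cyclicMap_comp_ringHom (Ideal.Quotient.mk (Ideal.span {(3 : R)}))
      (1 : ZMod n) (3 ^ r) w) i
    rw [iterate_cyclicMap_eq_id h3 r hn] at this
    exact this.symm
  let E : (ZMod n → R) → ZMod n → R := fun x i => x i ^ 3 - L x i
  let N : (ZMod n → R) → ZMod n → R := fun x => x + M (E x)
  have hstep (k : ℕ) (x) (hx : ∀ i, 3 ^ (k + 1) ∣ E x i) (i) : 3 ^ (k + 2) ∣ E (N x) i := by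
    have h1 : E (N x) i = 3 * (x i ^ 2 * M (E x) i + x i * M (E x) i ^ 2) + M (E x) i ^ 3
        - (L (M (E x)) i - E x i) := by
      simp only [E, N, map_add, Pi.add_apply]
      ring
    have h2 := hM_dvd _ _ hx i
    have h3 := hLM_dvd _ _ hx i
    rw [h1]
    refine dvd_sub (dvd_add ?_ ?_) h3
    · rw [pow_succ' _ (k + 1)]
      exact mul_dvd_mul_left _ (dvd_add (h2.mul_left _) ((dvd_pow h2 two_ne_zero).mul_left _))
    · refine (pow_dvd_pow _ (by lia : k + 2 ≤ (k + 1) * 3)).trans ?_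
      rw [pow_mul]
      exact pow_dvd_pow_of_dvd h2 3
  have hE (k : ℕ) (i) : 3 ^ (k + 1) ∣ E (N^[k] x₀) i := by
    induction k generalizing i with
    | zero => simpa [E] using h₀ i
    | succ k ih =>
      rw [Function.iterate_succ_apply']
      exact hstep k _ ih i
  have hsub (k l : ℕ) (i) : 3 ^ (k + 1) ∣ N^[k + l] x₀ i - N^[k] x₀ i := by
    induction l with
    | zero => simp
    | succ l ih =>
      have h1 : N^[k + (l + 1)] x₀ i = N^[k + l] x₀ i + M (E (N^[k + l] x₀)) i := by
        rw [← add_assoc, Function.iterate_succ_apply']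
        rfl
      rw [h1, add_sub_right_comm]
      exact dvd_add ih ((pow_dvd_pow _ (by lia)).trans (hM_dvd _ _ (hE (k + l)) i))
  have hlim (i) : ∃ y : R, ∀ k, 3 ^ k ∣ y - N^[k] x₀ i := by
    obtain ⟨y, hy⟩ := IsPrecomplete.prec' (I := Ideal.span {(3 : R)}) (M := R)
      (fun k => N^[k] x₀ i) (by
        intro k l hkl
        obtain ⟨l, rfl⟩ := Nat.exists_eq_add_of_le hkl
        rw [SModEq.comm, SModEq.sub_mem, smul_eq_mul, Ideal.mul_top, Ideal.span_singleton_pow,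
          Ideal.mem_span_singleton]
        exact (pow_dvd_pow _ (by lia)).trans (hsub k l i))
    refine ⟨y, fun k => ?_⟩
    have := (hy k).symm
    rwa [SModEq.sub_mem, smul_eq_mul, Ideal.mul_top, Ideal.span_singleton_pow,
      Ideal.mem_span_singleton] at this
  choose x hx using hlim
  refine ⟨x, fun i => ?_, fun i => ?_⟩
  · rw [← sub_eq_zero]
    refine IsHausdorff.haus' (I := Ideal.span {(3 : R)}) _ fun k => ?_
    rw [SModEq.zero, smul_eq_mul, Ideal.mul_top, Ideal.span_singleton_pow,
      Ideal.mem_span_singleton]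
    have h1 := (pow_dvd_pow (3 : R) (Nat.le_succ k)).trans (hE k i)
    have h2 (j) := hx j k
    have h3 : x i ^ 3 - L x i = E (N^[k] x₀) i + ((x i - N^[k] x₀ i) *
        (x i ^ 2 + x i * N^[k] x₀ i + N^[k] x₀ i ^ 2) - ((x i - N^[k] x₀ i) +
        (x (i - 1) - N^[k] x₀ (i - 1)) - (x (i + 1) - N^[k] x₀ (i + 1)))) := by
      simp only [E, hL, cyclicMap_apply]
      ring
    rw [h3]
    exact dvd_add h1 (dvd_sub ((h2 i).mul_right _) (dvd_sub (dvd_add (h2 _) (h2 _)) (h2 _)))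
  · have h1 := hx i 1
    have h2 := hsub 0 1 i
    simp only [zero_add, pow_one, Function.iterate_zero, id] at h1 h2
    simpa using dvd_add h1 h2

end cyclic

section counting

/-- Over a degree `3 ^ r` extension of `𝔽₃`, the system `x ^ 3 = L x` has at least `3 ^ n`
solutions, constructed from a normal basis. -/
theorem exists_injective_cube_eq_cyclicMap_of_finrank {k : Type*} [Field k] [Algebra (ZMod 3) k]
    [Finite k] {n r : ℕ} (hn : n = 2 * 3 ^ r) (hk : Module.finrank (ZMod 3) k = 3 ^ r) :
    ∃ φ : (ZMod n → ZMod 3) → ZMod n → k, Function.Injective φ ∧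
      ∀ v i, φ v i ^ 3 = cyclicMap k 1 (φ v) i := by
  have : FiniteDimensional (ZMod 3) k := Module.Finite.of_finite
  have : CharP k 3 := charP_of_injective_algebraMap' (ZMod 3) 3
  obtain ⟨b, hb⟩ := exists_linearIndependent_algEquiv_apply (ZMod 3) k
  set m := 3 ^ r
  have hli : LinearIndependent (ZMod 3) fun j : Fin m => b ^ 3 ^ (j : ℕ) := by
    let F := FiniteField.frobeniusAlgEquivOfAlgebraic (ZMod 3) k
    have hinj : Function.Injective fun j : Fin m => F ^ (j : ℕ) := by
      intro i j hij
      refine Fin.ext (pow_injOn_Iio_orderOf ?_ ?_ hij) <;>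
      simp [F, FiniteField.orderOf_frobeniusAlgEquivOfAlgebraic, hk]
    convert hb.comp _ hinj using 2 with j
    have := congrFun (FiniteField.coe_frobeniusAlgEquivOfAlgebraic_iterate (ZMod 3) k j) b
    rw [Function.comp_apply, AlgEquiv.coe_pow, this, ZMod.card]
  have hbm : b ^ 3 ^ m = b := by
    have := Fintype.ofFinite k
    have h := FiniteField.pow_card b
    rwa [Module.card_eq_pow_finrank (K := ZMod 3), ZMod.card, hk] at h
  let L := cyclicMap (ZMod 3) (1 : ZMod n)
  have hLm : L^[m] = id := iterate_cyclicMap_eq_id rfl r hn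
  let φ : (ZMod n → ZMod 3) → ZMod n → k := fun v i =>
    ∑ j ∈ Finset.range m, algebraMap (ZMod 3) k (L^[m - j] v i) * b ^ 3 ^ j
  refine ⟨φ, fun v w hvw => ?_, fun v i => ?_⟩
  · ext i
    have h0 : ∑ j : Fin m, (L^[m - j] v i - L^[m - j] w i) • b ^ 3 ^ (j : ℕ) = 0 := by
      have := congrFun hvw i
      simp only [φ, Finset.sum_range] at this
      simp only [Algebra.smul_def, map_sub, sub_mul, Finset.sum_sub_distrib, this, sub_self]
    have := Fintype.linearIndependent_iff.1 hli _ h0 ⟨0, by positivity⟩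
    simpa [hLm, sub_eq_zero] using this
  · let f : ℕ → k := fun j => algebraMap (ZMod 3) k (L^[m + 1 - j] v i) * b ^ 3 ^ j
    have h1 : φ v i ^ 3 = ∑ j ∈ Finset.range m, f (j + 1) := by
      rw [sum_pow_char]
      refine Finset.sum_congr rfl fun j _ => ?_
      rw [mul_pow, ← map_pow, ZMod.pow_card, ← pow_mul, ← pow_succ]
      simp [f]
    have h2 : cyclicMap k 1 (φ v) i = ∑ j ∈ Finset.range m, f j := by
      simp only [cyclicMap_apply, φ, ← Finset.sum_add_distrib, ← Finset.sum_sub_distrib]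
      refine Finset.sum_congr rfl fun j hj => ?_
      simp only [f]
      rw [Nat.sub_add_comm (Finset.mem_range.1 hj).le, Function.iterate_succ_apply',
        cyclicMap_apply, map_sub, map_add]
      ring
    have h3 : f m = f 0 := by
      have : L^[m + 1] v = L v := by rw [Function.iterate_succ_apply', hLm, id]
      simp [f, hbm, this]
    have h4 := (Finset.sum_range_succ f m).symm.trans (Finset.sum_range_succ' f m)
    rw [h1, h2]
    exact (add_right_cancel (h3 ▸ h4)).symm

/-- Solutions of `x ^ 3 = L x` in a field extension can be transferred to any algebraically closed
extension of the base field. -/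
theorem exists_injective_cube_eq_cyclicMap_of_field {ι F E K : Type*} [Field F] [Field E] [Field K]
    [Algebra F E] [Algebra F K] [IsAlgClosed K] {n : ℕ} [NeZero n] (ψ : ι → ZMod n → E)
    (hψ : Function.Injective ψ) (hψL : ∀ v i, ψ v i ^ 3 = cyclicMap E 1 (ψ v) i) :
    ∃ φ : ι → ZMod n → K, Function.Injective φ ∧ ∀ v i, φ v i ^ 3 = cyclicMap K 1 (φ v) i := by
  have hψE (v) (i) : ψ v i ∈ algebraicClosure F E := by
    rw [mem_algebraicClosure_iff, isAlgebraic_iff_isIntegral]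
    refine isIntegral_of_cube_mem_span (fun i => ?_) i
    rw [hψL, cyclicMap_apply]
    exact sub_mem (add_mem (Submodule.subset_span ⟨_, rfl⟩) (Submodule.subset_span ⟨_, rfl⟩))
      (Submodule.subset_span ⟨_, rfl⟩)
  let g : algebraicClosure F E →ₐ[F] K := IsAlgClosed.lift
  let χ (v) (i) : algebraicClosure F E := ⟨_, hψE v i⟩
  have hχ (v) (i) : χ v i ^ 3 = cyclicMap _ 1 (χ v) i := Subtype.ext (hψL v i)
  refine ⟨fun v => g ∘ χ v, fun v w hvw => hψ ?_, fun v i => ?_⟩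
  · ext i
    have h1 : χ v i = χ w i := g.injective (congrFun hvw i)
    exact congrArg Subtype.val h1
  · have := congrFun (cyclicMap_comp_ringHom (g : algebraicClosure F E →+* K) 1 (χ v)) i
    refine Eq.trans ?_ this.symm
    rw [Function.comp_apply, ← hχ, map_pow]
    rfl

theorem exists_injective_cube_eq_cyclicMap {K : Type*} [Field K] [CharZero K] [IsAlgClosed K]
    {n r : ℕ} (hn : n = 2 * 3 ^ r) :
    ∃ φ : (ZMod n → ZMod 3) → ZMod n → K, Function.Injective φ ∧
      ∀ v i, φ v i ^ 3 = cyclicMap K 1 (φ v) i := by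
  have : NeZero n := ⟨by rw [hn]; positivity⟩
  let k := GaloisField 3 (3 ^ r)
  obtain ⟨φ, hφ, hφL⟩ := exists_injective_cube_eq_cyclicMap_of_finrank (k := k) hn
    (GaloisField.finrank 3 (by positivity))
  let W := WittVector 3 k
  let c : W →+* k := WittVector.constantCoeff
  have hc (x : W) : 3 ∣ x ↔ c x = 0 := by
    rw [← Ideal.mem_span_singleton]
    exact_mod_cast WittVector.mem_span_p_iff_coeff_zero_eq_zero (p := 3) x
  have : IsAdicComplete (Ideal.span {(3 : W)}) W := by
    exact_mod_cast WittVector.isAdicCompleteIdealSpanP (p := 3) (k := k)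
  have hlift (v) : ∃ x : ZMod n → W, (∀ i, x i ^ 3 = cyclicMap W 1 x i) ∧ c ∘ x = φ v := by
    choose x₀ hx₀ using fun i => WittVector.constantCoeff_surjective (R := k) 3 (φ v i)
    have hx₀' : c ∘ x₀ = φ v := funext hx₀
    obtain ⟨x, hx, hxx⟩ := exists_lift_of_cube_eq_cyclicMap r hn x₀ (by
      intro i
      have h := congrFun (cyclicMap_comp_ringHom c 1 x₀) i
      rw [hx₀', ← hφL, Function.comp_apply, ← hx₀', Function.comp_apply] at h
      rw [hc, map_sub, map_pow, h, sub_self])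
    refine ⟨x, hx, ?_⟩
    rw [← hx₀']
    ext i
    simpa [hc, sub_eq_zero] using hxx i
  choose ψ hψL hψ using hlift
  have : CharZero W := by
    obtain ⟨q, hq⟩ := CharP.exists W
    rcases CharP.char_is_prime_or_zero W q with hp | rfl
    · have h : (q : k) = 0 := by
        rw [← map_natCast c, CharP.cast_eq_zero, map_zero]
      obtain rfl : 3 = q := (Nat.prime_dvd_prime_iff_eq Nat.prime_three hp).1
        ((CharP.cast_eq_zero_iff k 3 q).1 h)
      exact (WittVector.p_nonzero 3 k (CharP.cast_eq_zero W 3)).elim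
    · exact CharP.charP_to_charZero W
  let E := FractionRing W
  have hE := IsFractionRing.injective W E
  have : CharZero E := charZero_of_injective_algebraMap hE
  refine exists_injective_cube_eq_cyclicMap_of_field (F := ℚ) (fun v => algebraMap W E ∘ ψ v)
    (fun v w hvw => hφ ?_) fun v i => ?_
  · rw [← hψ, ← hψ, hE.comp_left hvw]
  · rw [cyclicMap_comp_ringHom, Function.comp_apply, Function.comp_apply, ← map_pow, hψL]

theorem encard_cube_eq_cyclicMap {K : Type*} [Field K] [CharZero K] [IsAlgClosed K]
    {n r : ℕ} (hn : n = 2 * 3 ^ r) :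
    {x : ZMod n → K | ∀ i, x i ^ 3 = cyclicMap K 1 x i}.encard = (3 ^ n : ℕ) := by
  have : NeZero n := ⟨by rw [hn]; positivity⟩
  set S := {x : ZMod n → K | ∀ i, x i ^ 3 = cyclicMap K 1 x i}
  have hle (T : Finset (ZMod n → K)) (hT : (T : Set (ZMod n → K)) ⊆ S) : T.card ≤ 3 ^ n := by
    refine (card_le_of_cube_mem_span T fun i => ?_).trans_eq (by rw [ZMod.card n])
    have : (fun P : T => P.1 i ^ 3) = (fun P : T => P.1 i) + (fun P : T => P.1 (i - 1)) -
        (fun P : T => P.1 (i + 1)) := funext fun P => hT P.2 i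
    rw [this]
    exact sub_mem (add_mem (Submodule.subset_span ⟨_, rfl⟩) (Submodule.subset_span ⟨_, rfl⟩))
      (Submodule.subset_span ⟨_, rfl⟩)
  have hfin : S.Finite := by
    by_contra hS
    obtain ⟨T, hT, hcard⟩ := Set.Infinite.exists_subset_card_eq hS (3 ^ n + 1)
    have := hle T hT
    lia
  refine le_antisymm ?_ ?_
  · rw [hfin.encard_eq_coe_toFinset_card]
    exact_mod_cast hle _ (by simp)
  · obtain ⟨φ, hφ, hφL⟩ := exists_injective_cube_eq_cyclicMap (K := K) hn
    have h := Set.encard_le_encard (show Set.range φ ⊆ S by rintro _ ⟨v, rfl⟩; exact hφL v)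
    rw [← Set.image_univ, hφ.encard_image, Set.encard_univ, ENat.card_eq_coe_fintype_card] at h
    simpa using h

end counting

section henon

theorem gA_iterate_of_cube_eq_cyclicMap {n : ℕ} {x : ZMod n → Qbar}
    (hx : ∀ i, x i ^ 3 = cyclicMap Qbar 1 x i) (k : ℕ) :
    gA^[k] (x 0, x 1) = (x k, x (k + 1)) := by
  induction k with
  | zero => simp
  | succ k ih =>
    rw [Function.iterate_succ_apply', ih, gA, hx, cyclicMap_apply]
    push_cast
    rw [add_sub_cancel_right]
    refine Prod.ext rfl ?_
    dsimp only
    ring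

theorem image_cube_eq_cyclicMap {n : ℕ} [NeZero n] :
    (fun x : ZMod n → Qbar => (x 0, x 1)) '' {x | ∀ i, x i ^ 3 = cyclicMap Qbar 1 x i} =
      {P | gA^[n] P = P} := by
  ext P
  constructor
  · rintro ⟨x, hx, rfl⟩
    simp [gA_iterate_of_cube_eq_cyclicMap hx]
  · intro hP
    let u : ℕ → Qbar := fun k => (gA^[k] P).1
    have hu (k : ℕ) : u (k + 2) = u k + u (k + 1) - u (k + 1) ^ 3 := by
      simp only [u, Function.iterate_succ_apply', gA]
    have hper (k : ℕ) : u (k % n) = u k := by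
      simp only [u]
      rw [Function.IsPeriodicPt.iterate_mod_apply hP]
    have hx (k : ℕ) : u (k : ZMod n).val = u k := by rw [ZMod.val_natCast, hper]
    refine ⟨fun i => u i.val, fun i => ?_, ?_⟩
    · obtain ⟨k, hk⟩ := ZMod.natCast_zmod_surjective (i - 1)
      obtain rfl : i = (k + 1 : ℕ) := by push_cast; rw [hk, sub_add_cancel]
      have h1 : ((k + 1 : ℕ) : ZMod n) - 1 = (k : ℕ) := by push_cast; ring
      have h2 : ((k + 1 : ℕ) : ZMod n) + 1 = (k + 2 : ℕ) := by push_cast; ring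
      rw [cyclicMap_apply, h1, h2]
      dsimp only
      rw [hx k, hx (k + 1), hx (k + 2), hu]
      ring
    · have h0 := hx 0
      have h1 := hx 1
      rw [Nat.cast_zero] at h0
      rw [Nat.cast_one] at h1
      dsimp only
      rw [h0, h1]
      rfl

theorem injOn_cube_eq_cyclicMap {n : ℕ} [NeZero n] :
    Set.InjOn (fun x : ZMod n → Qbar => (x 0, x 1))
      {x | ∀ i, x i ^ 3 = cyclicMap Qbar 1 x i} := by
  intro x hx y hy hxy
  ext i
  obtain ⟨k, rfl⟩ := ZMod.natCast_zmod_surjective i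
  have h := gA_iterate_of_cube_eq_cyclicMap hx k
  rw [show (x 0, x 1) = (y 0, y 1) from hxy, gA_iterate_of_cube_eq_cyclicMap hy k] at h
  exact (congrArg Prod.fst h).symm

instance : CharZero Qbar := inferInstanceAs (CharZero (AlgebraicClosure ℚ))

instance : IsAlgClosed Qbar := inferInstanceAs (IsAlgClosed (AlgebraicClosure ℚ))

end henon

/-- For `n = 2·3^r`, the set of points of `ℚ̄²` fixed by `g^n` has exactly `3^n` elements. -/
theorem stmt8 (r : ℕ) :
    {P : Qbar × Qbar | gA^[2 * 3 ^ r] P = P}.Finite ∧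
    {P : Qbar × Qbar | gA^[2 * 3 ^ r] P = P}.ncard = 3 ^ (2 * 3 ^ r) := by
  have : NeZero (2 * 3 ^ r) := ⟨by positivity⟩
  have h : {P : Qbar × Qbar | gA^[2 * 3 ^ r] P = P}.encard = (3 ^ (2 * 3 ^ r) : ℕ) := by
    rw [← image_cube_eq_cyclicMap, injOn_cube_eq_cyclicMap.encard_image,
      encard_cube_eq_cyclicMap rfl]
  exact ⟨Set.finite_of_encard_eq_coe h, by rw [Set.ncard, h, ENat.toNat_natCast]⟩
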